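/- Let a ∈ ℝ and let g, h : (a, ∞) → ℝ be three times continuously differentiable with g'(x) > 0 and h'(x) > 0 for all x > a. Assume: (C1) g(x) → +∞ and h(x) → +∞ as x → +∞; (C2) V_g(x) > V_h(x) for all x ∈ (a, ∞); (C3) there exists b ≥ a such that g(x) < h(x) for all x > b. Then g(x) < h(x) for all x > a. -/

import Mathlib

/-- The potential `V_f` associated with a function `f` via Liouville's transformation. -/
noncomputable def potential (f : ℝ → ℝ) (x : ℝ) : ℝ :=
  (deriv f x) ^ 2 + (1 / 2) * (deriv (deriv (deriv f)) x / deriv f x)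
    - (3 / 4) * (deriv (deriv f) x / deriv f x) ^ 2

open Set Filter Topology

/-- A `C³` function on an open half-line has three successive derivatives there. -/
theorem ContDiffOn.hasDerivAt_three {a : ℝ} {f : ℝ → ℝ} (hf : ContDiffOn ℝ 3 f (Ioi a))
    {x : ℝ} (hx : a < x) :
    HasDerivAt f (deriv f x) x ∧ HasDerivAt (deriv f) (deriv (deriv f) x) x ∧
      HasDerivAt (deriv (deriv f)) (deriv (deriv (deriv f)) x) x := by
  have h1 : ContDiffOn ℝ 2 (deriv f) (Ioi a) := hf.deriv_of_isOpen isOpen_Ioi (by norm_num)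
  have h2 : ContDiffOn ℝ 1 (deriv (deriv f)) (Ioi a) :=
    h1.deriv_of_isOpen isOpen_Ioi (by norm_num)
  have hmem : Ioi a ∈ 𝓝 x := Ioi_mem_nhds hx
  exact ⟨((hf.contDiffAt hmem).differentiableAt (by norm_num)).hasDerivAt,
    ((h1.contDiffAt hmem).differentiableAt (by norm_num)).hasDerivAt,
    ((h2.contDiffAt hmem).differentiableAt (by norm_num)).hasDerivAt⟩

/-- The Liouville solution `sin (f - c) / √f'` of `y'' + V_f y = 0`. -/
noncomputable def liouvilleSol (f : ℝ → ℝ) (c x : ℝ) : ℝ :=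
  (√(deriv f x))⁻¹ * Real.sin (f x - c)

/-- The derivative of `liouvilleSol`. -/
noncomputable def liouvilleSolDeriv (f : ℝ → ℝ) (c x : ℝ) : ℝ :=
  (√(deriv f x))⁻¹ * (deriv f x * Real.cos (f x - c)
    - deriv (deriv f) x / (2 * deriv f x) * Real.sin (f x - c))

theorem hasDerivAt_inv_sqrt {u : ℝ → ℝ} {u' x : ℝ} (hu : HasDerivAt u u' x) (hpos : 0 < u x) :
    HasDerivAt (fun t => (√(u t))⁻¹) (-(u' / (2 * u x)) * (√(u x))⁻¹) x := by
  have hs : 0 < √(u x) := Real.sqrt_pos.2 hpos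
  refine ((hu.sqrt hpos.ne').fun_inv hs.ne').congr_deriv ?_
  rw [Real.sq_sqrt hpos.le]
  field_simp

theorem hasDerivAt_liouvilleSol {a : ℝ} {f : ℝ → ℝ} (hf : ContDiffOn ℝ 3 f (Ioi a))
    (c : ℝ) {x : ℝ} (hx : a < x) (hpos : 0 < deriv f x) :
    HasDerivAt (liouvilleSol f c) (liouvilleSolDeriv f c x) x := by
  obtain ⟨h0, h1, -⟩ := hf.hasDerivAt_three hx
  refine ((hasDerivAt_inv_sqrt h1 hpos).mul (h0.sub_const c).sin).congr_deriv ?_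
  rw [liouvilleSolDeriv]
  ring

theorem hasDerivAt_liouvilleSolDeriv {a : ℝ} {f : ℝ → ℝ} (hf : ContDiffOn ℝ 3 f (Ioi a))
    (c : ℝ) {x : ℝ} (hx : a < x) (hpos : 0 < deriv f x) :
    HasDerivAt (liouvilleSolDeriv f c) (-(potential f x * liouvilleSol f c x)) x := by
  obtain ⟨h0, h1, h2⟩ := hf.hasDerivAt_three hx
  refine ((hasDerivAt_inv_sqrt h1 hpos).mul ((h1.mul (h0.sub_const c).cos).sub
    ((h2.div (h1.const_mul 2) (by positivity)).mul (h0.sub_const c).sin))).congr_deriv ?_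
  simp only [liouvilleSol, potential, Pi.mul_apply, Pi.sub_apply, Pi.div_apply]
  have hs : 0 < √(deriv f x) := Real.sqrt_pos.2 hpos
  generalize √(deriv f x) = p at *
  field_simp
  ring

theorem liouvilleSol_pos {f : ℝ → ℝ} {c x : ℝ} (hpos : 0 < deriv f x) (h0 : c < f x)
    (h1 : f x < c + Real.pi) : 0 < liouvilleSol f c x :=
  mul_pos (inv_pos.2 (Real.sqrt_pos.2 hpos))
    (Real.sin_pos_of_pos_of_lt_pi (by linarith) (by linarith))

/-- If `g` and `h` agree at `s` and `V_h < V_g`, then `g` cannot stay strictly below `h` up to the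
point where `h` has increased by `π`: Sturm comparison of the Liouville solutions. -/
theorem exists_le_of_potential_lt {a s t : ℝ} {g h : ℝ → ℝ}
    (hg : ContDiffOn ℝ 3 g (Ioi a)) (hh : ContDiffOn ℝ 3 h (Ioi a))
    (hg' : ∀ x, a < x → 0 < deriv g x) (hh' : ∀ x, a < x → 0 < deriv h x)
    (hV : ∀ x, a < x → potential h x < potential g x) (has : a < s) (hst : s < t)
    (hs : g s = h s) (ht : h t = h s + Real.pi) : ∃ x, s < x ∧ h x ≤ g x := by
  by_contra! hlt
  have mono {f : ℝ → ℝ} (hf : ContDiffOn ℝ 3 f (Ioi a)) (hf' : ∀ x, a < x → 0 < deriv f x) :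
      StrictMonoOn f (Ioi a) :=
    strictMonoOn_of_deriv_pos (convex_Ioi a) hf.continuousOn
      fun x hx => hf' x (by simpa using hx)
  have hgm := mono hg hg'
  have hhm := mono hh hh'
  have hat : a < t := has.trans hst
  set c := h s with hc
  let W : ℝ → ℝ := fun x => liouvilleSolDeriv g c x * liouvilleSol h c x
    - liouvilleSol g c x * liouvilleSolDeriv h c x
  have hW (x : ℝ) (hx : a < x) : HasDerivAt W
      ((potential h x - potential g x) * (liouvilleSol g c x * liouvilleSol h c x)) x := by
    refine (((hasDerivAt_liouvilleSolDeriv hg c hx (hg' x hx)).mul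
      (hasDerivAt_liouvilleSol hh c hx (hh' x hx))).sub
      ((hasDerivAt_liouvilleSol hg c hx (hg' x hx)).mul
      (hasDerivAt_liouvilleSolDeriv hh c hx (hh' x hx)))).congr_deriv ?_
    ring
  have hanti : StrictAntiOn W (Icc s t) := by
    refine strictAntiOn_of_deriv_neg (convex_Icc s t)
      (fun x hx => (hW x (has.trans_le hx.1)).continuousAt.continuousWithinAt) fun x hx => ?_
    rw [interior_Icc] at hx
    have hax : a < x := has.trans hx.1
    rw [(hW x hax).deriv]
    have h1 : g s < g x := hgm has hax hx.1
    have h2 : h x < h t := hhm hax hat hx.2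
    have h3 := hlt x hx.1
    exact mul_neg_of_neg_of_pos (sub_neg.2 (hV x hax))
      (mul_pos (liouvilleSol_pos (hg' x hax) (by linarith) (by linarith))
        (liouvilleSol_pos (hh' x hax) (by linarith) (by linarith)))
  have hlast := hanti (left_mem_Icc.2 hst.le) (right_mem_Icc.2 hst.le) hst
  have hWs : W s = 0 := by simp [W, liouvilleSol, hs, ← hc]
  have hWt : W t = liouvilleSol g c t * ((√(deriv h t))⁻¹ * deriv h t) := by
    simp [W, liouvilleSol, liouvilleSolDeriv, ht]
  have hgt : g s < g t := hgm has hat hst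
  have hgt' := hlt t hst
  have hpos := liouvilleSol_pos (c := c) (hg' t hat) (by linarith) (by linarith)
  have hpos' : 0 < (√(deriv h t))⁻¹ * deriv h t :=
    mul_pos (inv_pos.2 (Real.sqrt_pos.2 (hh' t hat))) (hh' t hat)
  have := mul_pos hpos hpos'
  linarith

/-- A consequence of the Sturm comparison theorem: if `g`, `h` are `C³` on `(a, ∞)` with
positive derivatives, both tend to `+∞` at `+∞`, `V_g > V_h` on `(a, ∞)`, and `g < h`
eventually (beyond some `b ≥ a`), then `g < h` on all of `(a, ∞)`. -/
theorem sturm_consequence (a : ℝ) (g h : ℝ → ℝ)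
    (hg : ContDiffOn ℝ 3 g (Set.Ioi a)) (hh : ContDiffOn ℝ 3 h (Set.Ioi a))
    (hg' : ∀ x, a < x → 0 < deriv g x) (hh' : ∀ x, a < x → 0 < deriv h x)
    (hC1g : Filter.Tendsto g Filter.atTop Filter.atTop)
    (hC1h : Filter.Tendsto h Filter.atTop Filter.atTop)
    (hC2 : ∀ x, a < x → potential h x < potential g x)
    (hC3 : ∃ b, a ≤ b ∧ ∀ x, b < x → g x < h x) :
    ∀ x, a < x → g x < h x := by
  intro c hac
  by_contra! hle
  obtain ⟨b, -, hb⟩ := hC3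
  have hsub : Icc c (max b c) ⊆ Ioi a := fun x hx => hac.trans_le hx.1
  have hK : IsCompact {x ∈ Icc c (max b c) | h x ≤ g x} :=
    isCompact_Icc.of_isClosed_subset (isClosed_Icc.isClosed_le (hh.continuousOn.mono hsub)
      (hg.continuousOn.mono hsub)) (sep_subset _ _)
  obtain ⟨s, ⟨⟨hcs, -⟩, hhs⟩, hmax⟩ :=
    hK.exists_isGreatest ⟨c, left_mem_Icc.2 (le_max_right b c), hle⟩
  have has : a < s := hac.trans_le hcs
  have hlt (x : ℝ) (hx : s < x) : g x < h x := by
    rcases lt_or_ge (max b c) x with h1 | h1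
    · exact hb x ((le_max_left b c).trans_lt h1)
    · by_contra! h2
      exact hx.not_ge (hmax ⟨⟨hcs.trans hx.le, h1⟩, h2⟩)
  have hgs : g s ≤ h s :=
    le_of_tendsto_of_tendsto
      ((hg.contDiffAt (Ioi_mem_nhds has)).continuousAt.tendsto.mono_left nhdsWithin_le_nhds)
      ((hh.contDiffAt (Ioi_mem_nhds has)).continuousAt.tendsto.mono_left nhdsWithin_le_nhds)
      (eventually_nhdsWithin_of_forall fun x (hx : x ∈ Ioi s) => (hlt x hx).le)
  obtain ⟨B, hB, hsB⟩ :=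
    ((hC1h.eventually_ge_atTop (h s + Real.pi)).and (eventually_ge_atTop s)).exists
  obtain ⟨t, htm, ht⟩ := intermediate_value_Icc hsB
    (hh.continuousOn.mono fun x hx => has.trans_le hx.1)
    (show h s + Real.pi ∈ Icc (h s) (h B) from ⟨by linarith [Real.pi_pos], hB⟩)
  have hst : s < t := htm.1.lt_of_ne fun h0 => by
    subst h0
    linarith [Real.pi_pos]
  obtain ⟨x, hx, hxle⟩ :=
    exists_le_of_potential_lt hg hh hg' hh' hC2 has hst (hgs.antisymm hhs) ht
  exact hxle.not_gt (hlt x hx)
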